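/- Let u, v ∈ ℕ and let M be a u × v matrix with entries from ℝ⁺ ∪ {0} which is image partition regular over ℝ⁺. If C ⊆ ℝ⁺ is a strongly central* (SC*) set near zero in ℝ⁺, then {x ∈ (ℝ⁺)^v : M·x ∈ C^u} is an SC* set near zero in (ℝ⁺)^v. -/

import Mathlib

open Set Filter

attribute [local instance] Ultrafilter.add Ultrafilter.addSemigroup

/-- The positive reals `ℝ⁺ = (0,∞)` as a type, a discrete additive semigroup. -/
abbrev Rpos : Type := {x : ℝ // 0 < x}

/-- `0⁺(ℝ⁺)`: ultrafilters on `ℝ⁺` containing `(0,ε)` for every `ε > 0`. -/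
def zeroPlus1 : Set (Ultrafilter Rpos) :=
  {p | ∀ ε : ℝ, 0 < ε → {x : Rpos | (x : ℝ) < ε} ∈ p}

/-- `0⁺((ℝ⁺)^v)`: ultrafilters on `(ℝ⁺)^v` containing `(0,ε)^v` for every `ε > 0`. -/
def zeroPlusV (v : ℕ) : Set (Ultrafilter (Fin v → Rpos)) :=
  {p | ∀ ε : ℝ, 0 < ε → {x : Fin v → Rpos | ∀ j, (x j : ℝ) < ε} ∈ p}

/-- `L` is a left ideal of the subsemigroup `T` of the ultrafilter semigroup `βγ`. -/
def IsLeftIdealIn {γ : Type} [AddSemigroup γ] (T L : Set (Ultrafilter γ)) : Prop :=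
  L.Nonempty ∧ L ⊆ T ∧ ∀ p ∈ T, ∀ q ∈ L, p + q ∈ L

/-- `L` is a minimal left ideal of the subsemigroup `T`. -/
def IsMinimalLeftIdealIn {γ : Type} [AddSemigroup γ] (T L : Set (Ultrafilter γ)) : Prop :=
  IsLeftIdealIn T L ∧ ∀ L' : Set (Ultrafilter γ), IsLeftIdealIn T L' → L' ⊆ L → L' = L

/-- `M` is image partition regular over `ℝ⁺` (IPR/ℝ⁺): whenever `ℝ⁺` is partitioned into
finitely many cells, there are a cell `i` and `x ∈ (ℝ⁺)^v` such that every entry of `M·x`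
lies in `ℝ⁺` and in the cell `i`. -/
def IPR {u v : ℕ} (M : Fin u → Fin v → ℝ) : Prop :=
  ∀ (r : ℕ) (c : Rpos → Fin r), ∃ (i : Fin r) (x : Fin v → Rpos),
    ∀ k : Fin u, ∃ h : 0 < ∑ j, M k j * (x j : ℝ), c ⟨∑ j, M k j * (x j : ℝ), h⟩ = i

/-- `A ⊆ ℝ⁺` is a *strongly central\* (SC\*) set near zero*: there is a minimal left ideal
`L` of `0⁺(ℝ⁺)` with `A` belonging to every idempotent of `L`. -/
def SCStar1 (A : Set Rpos) : Prop :=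
  ∃ L : Set (Ultrafilter Rpos), IsMinimalLeftIdealIn zeroPlus1 L ∧
    ∀ r ∈ L, r + r = r → A ∈ r

/-- `A ⊆ (ℝ⁺)^v` is a *strongly central\* (SC\*) set near zero*: there is a minimal left
ideal `L` of `0⁺((ℝ⁺)^v)` with `A` belonging to every idempotent of `L`. -/
def SCStarV (v : ℕ) (A : Set (Fin v → Rpos)) : Prop :=
  ∃ L : Set (Ultrafilter (Fin v → Rpos)), IsMinimalLeftIdealIn (zeroPlusV v) L ∧
    ∀ r ∈ L, r + r = r → A ∈ r

open Topology

/-- The ratio of two positive functions with the same pushforward ultrafilter converges only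
to `0` or `1`. -/
theorem ratio_limit_of_map_eq {X : Type*} (p : Ultrafilter X) (a b : X → ℝ)
    (ha : ∀ᶠ x in p, 0 < a x) (hb : ∀ᶠ x in p, 0 < b x)
    (hab : p.map a = p.map b) (c : ℝ)
    (hc : Tendsto (fun x => a x / b x) p (𝓝 c)) : c = 0 ∨ c = 1 := by
  by_contra! hne
  have hc0 : 0 ≤ c := ge_of_tendsto hc (by
    filter_upwards [ha, hb] with x hx hy using (div_pos hx hy).le)
  have hcpos : 0 < c := lt_of_le_of_ne hc0 hne.1.symm
  have hd : Real.log c ≠ 0 := Real.log_ne_zero_of_pos_of_ne_one hcpos hne.2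
  set f : ℝ → ℝ := fun t => 2 * Real.log t / Real.log c with hf
  have hlim : Tendsto (fun x => f (a x) - f (b x)) p (𝓝 2) := by
    have h1 : Tendsto (fun x => 2 * Real.log (a x / b x) / Real.log c) p
        (𝓝 (2 * Real.log c / Real.log c)) :=
      ((hc.log hcpos.ne').const_mul 2).div_const _
    rw [mul_div_cancel_right₀ _ hd] at h1
    refine h1.congr' ?_
    filter_upwards [ha, hb] with x hx hy
    simp only [hf]
    rw [Real.log_div hx.ne' hy.ne']
    ring
  have hclose : ∀ᶠ x in p, f (a x) - f (b x) ∈ Ioo (3 / 2 : ℝ) (5 / 2) :=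
    hlim (Ioo_mem_nhds (by norm_num) (by norm_num))
  have hmod : ∀ᶠ x in p, ⌊f (a x)⌋ % 4 ∈ Finset.Ico (0 : ℤ) 4 :=
    Eventually.of_forall fun x => Finset.mem_Ico.2 (by omega)
  have hcol : ∃ k ∈ Finset.Ico (0 : ℤ) 4, ∀ᶠ x in p, ⌊f (a x)⌋ % 4 = k :=
    (Ultrafilter.eventually_exists_mem_iff (f := p)
      (is := (Finset.Ico (0 : ℤ) 4 : Set ℤ)) (Finset.finite_toSet _)
      (P := fun k x => ⌊f (a x)⌋ % 4 = k)).1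
      (hmod.mono fun x hx => ⟨_, hx, rfl⟩)
  obtain ⟨k, -, hk⟩ := hcol
  have hk' : ∀ᶠ x in p, ⌊f (b x)⌋ % 4 = k := by
    have h1 : {t | ⌊f t⌋ % 4 = k} ∈ p.map a := hk
    rw [hab] at h1
    exact h1
  obtain ⟨x, hx1, hx2, hx3, hx4⟩ := (hk.and (hk'.and hclose)).exists
  have e1 := Int.floor_le (f (a x))
  have e2 := Int.lt_floor_add_one (f (a x))
  have e3 := Int.floor_le (f (b x))
  have e4 := Int.lt_floor_add_one (f (b x))
  have l1 : ((⌊f (b x)⌋ : ℤ) : ℝ) < (⌊f (a x)⌋ : ℤ) := by linarith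
  have l2 : ((⌊f (a x)⌋ : ℤ) : ℝ) < ((⌊f (b x)⌋ + 4 : ℤ) : ℝ) := by push_cast; linarith
  have l1' := Int.cast_lt.1 l1
  have l2' := Int.cast_lt.1 l2
  omega

/-- Along an ultrafilter, a nowhere vanishing vector-valued function has a leading direction:
it is `t • ξ` up to an error with one more vanishing coordinate. -/
theorem exists_leading_direction {X ι : Type*} [Fintype ι] [DecidableEq ι] (p : Ultrafilter X)
    (S : Finset ι) (g : X → ι → ℝ) (hS : ∀ᶠ x in p, ∀ j ∉ S, g x j = 0)
    (hg : ∀ᶠ x in p, g x ≠ 0) :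
    ∃ (t : X → ℝ) (ξ : ι → ℝ), ∃ j₀ ∈ S, (∀ᶠ x in p, 0 < t x) ∧
      Tendsto (fun x => (t x)⁻¹ • g x) p (𝓝 ξ) ∧
      ∀ᶠ x in p, ∀ j ∉ S.erase j₀, (g x - t x • ξ) j = 0 := by
  have hmax : ∀ᶠ x in p, ∃ j, ‖g x j‖ = ‖g x‖ := by
    filter_upwards [hg] with x hx
    have : Nonempty ι := by
      by_contra h
      rw [not_nonempty_iff] at h
      exact hx (Subsingleton.elim _ _)
    obtain ⟨j, hj⟩ := Finite.exists_max fun j => ‖g x j‖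
    exact ⟨j, (norm_le_pi_norm _ j).antisymm ((pi_norm_le_iff_of_nonneg (norm_nonneg _)).2 hj)⟩
  obtain ⟨j₀, hj₀⟩ := Ultrafilter.eventually_exists_iff.1 hmax
  obtain ⟨s, hs, hst⟩ : ∃ s : ℝ, s * s = 1 ∧ ∀ᶠ x in p, s * g x j₀ = ‖g x‖ := by
    have : ∀ᶠ x in p, (g x j₀ = ‖g x‖ ∨ -g x j₀ = ‖g x‖) := by
      filter_upwards [hj₀] with x hx
      rw [← hx, Real.norm_eq_abs]
      rcases abs_choice (g x j₀) with h | h <;> simp [h]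
    rcases Ultrafilter.eventually_or.1 this with h | h
    · exact ⟨1, by norm_num, by simpa using h⟩
    · exact ⟨-1, by norm_num, by simpa using h⟩
  have hpos : ∀ᶠ x in p, 0 < ‖g x‖ := hg.mono fun x hx => norm_pos_iff.2 hx
  have hball : ∀ᶠ x in p, ‖g x‖⁻¹ • g x ∈ Metric.closedBall (0 : ι → ℝ) 1 := by
    filter_upwards [hpos] with x hx
    rw [mem_closedBall_zero_iff, norm_smul, norm_inv, norm_norm, inv_mul_cancel₀ hx.ne']
  obtain ⟨ξ, -, hξ⟩ := (isCompact_closedBall (0 : ι → ℝ) 1).ultrafilter_le_nhds'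
    (p.map fun x => ‖g x‖⁻¹ • g x) hball
  have hξ' : Tendsto (fun x => ‖g x‖⁻¹ • g x) p (𝓝 ξ) := hξ
  have hcoord : ∀ j, Tendsto (fun x => ‖g x‖⁻¹ * g x j) p (𝓝 (ξ j)) := fun j =>
    (tendsto_pi_nhds.1 hξ') j
  have hξj₀ : ξ j₀ = s := by
    refine tendsto_nhds_unique (hcoord j₀) (tendsto_const_nhds.congr' ?_)
    filter_upwards [hst, hpos] with x hx hp
    rw [eq_comm, inv_mul_eq_iff_eq_mul₀ hp.ne', ← hx]
    linear_combination (-(g x j₀)) * hs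
  have hξS : ∀ j ∉ S, ξ j = 0 := fun j hj => by
    refine tendsto_nhds_unique (hcoord j) (tendsto_const_nhds.congr' ?_)
    filter_upwards [hS] with x hx
    simp [hx j hj]
  refine ⟨fun x => ‖g x‖, ξ, j₀, ?_, hpos, hξ', ?_⟩
  · by_contra hj
    obtain ⟨x, h1, h2, h3⟩ := (hS.and (hst.and hpos)).exists
    rw [h1 j₀ hj] at h2
    linarith
  · filter_upwards [hS, hst] with x h1 h2 j hj
    simp only [Pi.sub_apply, Pi.smul_apply, smul_eq_mul]
    by_cases hjj : j = j₀
    · subst hjj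
      rw [hξj₀, ← h2]
      linear_combination (-(g x j)) * hs
    · have hjS : j ∉ S := fun h => hj (Finset.mem_erase.2 ⟨hjj, h⟩)
      rw [h1 j hjS, hξS j hjS]
      ring

/-- If finitely many functionals are positive on `g` along an ultrafilter, and comparable ones
have ratio tending to `1`, then every additively thick set near zero contains the values of these
functionals at arbitrarily small vectors, which can be kept inside any finite family of open
half-spaces that contain `g`. -/
theorem frequently_forall_mem_of_thick {X ι κ τ : Type*} [Fintype ι] [DecidableEq ι]
    [Finite κ] [Finite τ] (p : Ultrafilter X) (q : Filter ℝ) [q.NeBot] (hq : q ≤ 𝓝 0)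
    (A : Set ℝ) (hA : ∀ᶠ x in 𝓝[>] (0 : ℝ), ∀ᶠ y in q, x + y ∈ A)
    (Λ : κ → (ι → ℝ) →L[ℝ] ℝ) (Θ : τ → (ι → ℝ) →L[ℝ] ℝ) (S : Finset ι) :
    ∀ (I : Set κ) (J : Set τ) (g : X → ι → ℝ), (∀ᶠ x in p, ∀ j ∉ S, g x j = 0) →
      (∀ i ∈ I, ∀ᶠ x in p, 0 < Λ i (g x)) →
      (∀ i ∈ I, ∀ k ∈ I, ∀ c,
        Tendsto (fun x => Λ i (g x) / Λ k (g x)) p (𝓝 c) → c = 0 ∨ c = 1) →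
      (∀ j ∈ J, ∀ᶠ x in p, 0 < Θ j (g x)) →
      ∃ᶠ y in 𝓝 (0 : ι → ℝ), (∀ i ∈ I, Λ i y ∈ A) ∧ ∀ j ∈ J, 0 < Θ j y := by
  induction S using Finset.strongInduction with
  | H S ih =>
  intro I J g hS hI hratio hJ
  rcases p.em (fun x => g x = 0) with h0 | h0
  · refine (Eventually.of_forall fun y => ⟨fun i hi => ?_, fun j hj => ?_⟩).frequently
    · obtain ⟨x, h1, h2⟩ := (h0.and (hI i hi)).exists
      simp [h1] at h2
    · obtain ⟨x, h1, h2⟩ := (h0.and (hJ j hj)).exists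
      simp [h1] at h2
  obtain ⟨t, ξ, j₀, hj₀, ht, hξ, hsupp⟩ := exists_leading_direction p S g hS h0
  have hlim : ∀ φ : (ι → ℝ) →L[ℝ] ℝ, Tendsto (fun x => (t x)⁻¹ * φ (g x)) p (𝓝 (φ ξ)) := by
    intro φ
    have := (φ.continuous.tendsto ξ).comp hξ
    simpa [Function.comp_def] using this
  have hnonneg : ∀ φ : (ι → ℝ) →L[ℝ] ℝ, (∀ᶠ x in p, 0 < φ (g x)) → 0 ≤ φ ξ := by
    intro φ hφ
    refine ge_of_tendsto (hlim φ) ?_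
    filter_upwards [hφ, ht] with x h1 h2 using (mul_pos (inv_pos.2 h2) h1).le
  obtain ⟨c, hc, hcI⟩ : ∃ c : ℝ, 0 < c ∧ ∀ i ∈ I, Λ i ξ = 0 ∨ Λ i ξ = c := by
    by_cases hex : ∃ k ∈ I, Λ k ξ ≠ 0
    · obtain ⟨k, hk, hk0⟩ := hex
      refine ⟨Λ k ξ, lt_of_le_of_ne (hnonneg _ (hI k hk)) hk0.symm, fun i hi => ?_⟩
      have h1 := (hlim (Λ i)).div (hlim (Λ k)) hk0
      have h2 : Tendsto (fun x => Λ i (g x) / Λ k (g x)) p (𝓝 (Λ i ξ / Λ k ξ)) := by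
        refine h1.congr' ?_
        filter_upwards [ht] with x hx
        exact mul_div_mul_left _ _ (inv_pos.2 hx).ne'
      rcases hratio i hi k hk _ h2 with h | h
      · left
        simpa [hk0] using h
      · right
        exact (div_eq_one_iff_eq hk0).1 h
    · push Not at hex
      exact ⟨1, one_pos, fun i hi => Or.inl (hex i hi)⟩
  have hker : ∀ φ : (ι → ℝ) →L[ℝ] ℝ, φ ξ = 0 → ∀ x, φ (g x - t x • ξ) = φ (g x) := by
    intro φ hφ x
    simp [hφ]
  have hIH := ih (S.erase j₀) (Finset.erase_ssubset hj₀) {i ∈ I | Λ i ξ = 0} {j ∈ J | Θ j ξ = 0}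
    (fun x => g x - t x • ξ) hsupp
    (fun i hi => by simpa only [hker _ hi.2] using hI i hi.1)
    (fun i hi k hk d hd => by
      simp only [hker _ hi.2, hker _ hk.2] at hd
      exact hratio i hi.1 k hk.1 d hd)
    (fun j hj => by simpa only [hker _ hj.2] using hJ j hj.1)
  obtain ⟨ε, hε, hεA⟩ := mem_nhdsGT_iff_exists_Ioo_subset.1 hA
  rw [frequently_iff]
  intro U hU
  obtain ⟨V, hVU, hV, hV0⟩ := mem_nhds_iff.1 hU
  obtain ⟨δ, hδ, hδV, hδε⟩ : ∃ δ : ℝ, 0 < δ ∧ δ • ξ ∈ V ∧ c * δ < ε := by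
    have h1 : ∀ᶠ δ : ℝ in 𝓝 0, δ • ξ ∈ V :=
      ((continuous_id.smul continuous_const).tendsto' (0 : ℝ) (0 : ι → ℝ) (by simp)).eventually
        (hV.mem_nhds hV0)
    have h2 : ∀ᶠ δ : ℝ in 𝓝 0, c * δ < ε :=
      ((continuous_const.mul continuous_id).tendsto' (0 : ℝ) (0 : ℝ) (by simp)).eventually
        (gt_mem_nhds hε)
    obtain ⟨δ, ⟨h1, h2⟩, h3⟩ :=
      (((h1.and h2).filter_mono nhdsWithin_le_nhds).and (self_mem_nhdsWithin (s := Ioi 0))).exists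
    exact ⟨δ, h3, h1, h2⟩
  have hcont : Continuous fun w : (ι → ℝ) × ℝ => (δ + w.2) • ξ + w.1 := by fun_prop
  have hev : ∀ᶠ w in 𝓝 (0 : ι → ℝ) ×ˢ 𝓝 (0 : ℝ), (δ + w.2) • ξ + w.1 ∈ V ∧
      ∀ j ∈ {j ∈ J | Θ j ξ ≠ 0}, 0 < Θ j ((δ + w.2) • ξ + w.1) := by
    rw [← nhds_prod_eq]
    refine Eventually.and ?_ ((eventually_all_finite (Set.toFinite _)).2 fun j hj => ?_)
    · exact hcont.continuousAt.eventually (hV.mem_nhds (by simpa using hδV))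
    · refine ((Θ j).continuous.comp hcont).continuousAt.eventually (lt_mem_nhds ?_)
      have : 0 < Θ j ξ := lt_of_le_of_ne (hnonneg _ (hJ j hj.1)) hj.2.symm
      simpa using mul_pos hδ this
  have hrow : ∀ᶠ h in 𝓝 (0 : ι → ℝ), ∀ i, c * δ + Λ i h ∈ Ioo 0 ε := by
    refine eventually_all.2 fun i => ?_
    have : Continuous fun h => c * δ + Λ i h := by fun_prop
    exact this.continuousAt.eventually
      (isOpen_Ioo.mem_nhds (by simpa using ⟨mul_pos hc hδ, hδε⟩))
  obtain ⟨h, ⟨hIh, hJh⟩, hh, hrowh⟩ := (hIH.and_eventually (hev.curry.and hrow)).exists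
  have hdiv : Tendsto (fun y : ℝ => y / c) q (𝓝 0) :=
    ((continuous_id.div_const c).tendsto' 0 0 (by simp)).mono_left hq
  have hrowA : ∀ᶠ y in q, ∀ i, c * δ + Λ i h + y ∈ A :=
    eventually_all.2 fun i => hεA (hrowh i)
  obtain ⟨y, ⟨hyV, hyJ⟩, hyA⟩ := ((hdiv.eventually hh).and hrowA).exists
  refine ⟨(δ + y / c) • ξ + h, hVU hyV, fun i hi => ?_, fun j hj => ?_⟩
  · rcases hcI i hi with h1 | h1
    · simpa [h1] using hIh i ⟨hi, h1⟩
    · convert hyA i using 1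
      simp only [map_add, map_smul, smul_eq_mul, h1]
      field_simp
      ring
  · by_cases h1 : Θ j ξ = 0
    · simpa [h1] using hJh j ⟨hj, h1⟩
    · exact hyJ j ⟨hj, h1⟩

/-- In a closed subsemigroup of the ultrafilter semigroup, every left ideal contains a minimal
left ideal. -/
theorem exists_minimalLeftIdeal_subset {γ : Type} [AddSemigroup γ] (T : Set (Ultrafilter γ))
    (hT : IsClosed T) (hadd : ∀ p ∈ T, ∀ q ∈ T, p + q ∈ T) (L : Set (Ultrafilter γ))
    (hL : IsLeftIdealIn T L) : ∃ N ⊆ L, IsMinimalLeftIdealIn T N := by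
  have hprin : ∀ q ∈ T, IsLeftIdealIn T ((· + q) '' T) ∧ IsClosed ((· + q) '' T) := by
    intro q hq
    refine ⟨⟨⟨_, mem_image_of_mem _ hq⟩, ?_, ?_⟩, ?_⟩
    · rintro _ ⟨t, ht, rfl⟩
      exact hadd t ht q hq
    · rintro s hs _ ⟨t, ht, rfl⟩
      exact ⟨s + t, hadd s hs t ht, add_assoc s t q⟩
    · exact (hT.isCompact.image (Ultrafilter.continuous_add_left q)).isClosed
  have hsub : ∀ K, IsLeftIdealIn T K → ∀ q ∈ K, (· + q) '' T ⊆ K := by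
    rintro K hK q hq _ ⟨t, ht, rfl⟩
    exact hK.2.2 t ht q hq
  obtain ⟨q, hq⟩ := hL.1
  obtain ⟨N, hN⟩ := zorn_superset {K | IsLeftIdealIn T K ∧ IsClosed K ∧ K ⊆ (· + q) '' T} (by
    intro c hc hchain
    rcases c.eq_empty_or_nonempty with rfl | hne
    · exact ⟨_, ⟨(hprin q (hL.2.1 hq)).1, (hprin q (hL.2.1 hq)).2, Subset.rfl⟩, by simp⟩
    · obtain ⟨K, hK⟩ := hne
      refine ⟨⋂₀ c, ⟨⟨?_, ?_, ?_⟩, ?_, ?_⟩, fun s hs => sInter_subset_of_mem hs⟩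
      · have : Nonempty c := ⟨⟨K, hK⟩⟩
        exact IsCompact.nonempty_sInter_of_directed_nonempty_isCompact_isClosed
          (fun s hs t ht => (hchain.total hs ht).elim
            (fun h => ⟨s, hs, Subset.rfl, h⟩) fun h => ⟨t, ht, h, Subset.rfl⟩)
          (fun s hs => (hc hs).1.1)
          (fun s hs => (hc hs).2.1.isCompact) (fun s hs => (hc hs).2.1)
      · exact (sInter_subset_of_mem hK).trans (hc hK).1.2.1
      · exact fun p hp r hr s hs => (hc hs).1.2.2 p hp r (hr s hs)
      · exact isClosed_sInter fun s hs => (hc hs).2.1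
      · exact (sInter_subset_of_mem hK).trans (hc hK).2.2)
  obtain ⟨hNL, hNc, hNq⟩ := hN.prop
  refine ⟨N, hNq.trans (hsub L hL q hq), hNL, fun K hK hKN => hKN.antisymm ?_⟩
  obtain ⟨r, hr⟩ := hK.1
  have hrK := hsub K hK r hr
  obtain ⟨h1, h2⟩ := hprin r (hK.2.1 hr)
  exact (hN.le_of_le ⟨h1, h2, (hrK.trans hKN).trans hNq⟩ (hrK.trans hKN)).trans hrK

/-- The filter of neighbourhoods of zero in `ℝ⁺`. -/
def nearZero : Filter Rpos := comap (↑) (𝓝 (0 : ℝ))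

theorem map_coe_nearZero : map ((↑) : Rpos → ℝ) nearZero = 𝓝[>] 0 := by
  rw [nearZero, map_comap, Subtype.range_coe_subtype]
  rfl

theorem eventually_lt_nearZero {ε : ℝ} (hε : 0 < ε) : ∀ᶠ x : Rpos in nearZero, (x : ℝ) < ε :=
  tendsto_comap.eventually (gt_mem_nhds hε)

theorem mem_zeroPlus1_iff {p : Ultrafilter Rpos} :
    p ∈ zeroPlus1 ↔ (p : Filter Rpos) ≤ nearZero := by
  refine ⟨fun h => ?_, fun h ε hε => h (eventually_lt_nearZero hε)⟩
  rw [nearZero, ← map_le_iff_le_comap]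
  refine (nhds_basis_abs_sub_lt (0 : ℝ)).ge_iff.2 fun ε hε => ?_
  refine mem_map.2 ?_
  filter_upwards [h ε hε] with x hx
  simpa [abs_of_pos x.2] using hx

/-- An ultrafilter containing every set that belongs to all `t + q` with `t` near zero is itself
of this form. -/
theorem exists_eq_add_of_le {q r : Ultrafilter Rpos}
    (hr : ∀ A : Set Rpos, (∀ᶠ x in nearZero, ∀ᶠ y in q, x + y ∈ A) → A ∈ r) :
    ∃ t ∈ zeroPlus1, r = t + q := by
  have hmono : Monotone fun A : Set Rpos => {x | ∀ᶠ y in q, x + y ∈ A} :=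
    fun A B hAB x hx => hx.mono fun y hy => hAB hy
  have hne : NeBot (nearZero ⊓ (r : Filter Rpos).lift' fun A => {x | ∀ᶠ y in q, x + y ∈ A}) := by
    rw [inf_comm, inf_neBot_iff_frequently_left]
    intro P hP
    obtain ⟨A, hA, hAP⟩ := (mem_lift'_sets hmono).1 hP
    intro hnot
    have : Aᶜ ∈ r := hr _ (hnot.mono fun x hx => by
      have : ¬ ∀ᶠ y in q, x + y ∈ A := fun h => hx (hAP h)
      exact Ultrafilter.eventually_not.2 this)
    exact Ultrafilter.compl_mem_iff_notMem.1 this hA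
  obtain ⟨t, ht⟩ := exists_ultrafilter_le (nearZero ⊓
    (r : Filter Rpos).lift' fun A => {x | ∀ᶠ y in q, x + y ∈ A})
  refine ⟨t, mem_zeroPlus1_iff.2 (ht.trans inf_le_left), ?_⟩
  refine (Ultrafilter.coe_le_coe.1 fun A hA => ?_).symm
  exact (Ultrafilter.eventually_add t q (· ∈ A)).2 ((ht.trans inf_le_right) (mem_lift' hA))

theorem isClosed_zeroPlusV (v : ℕ) : IsClosed (zeroPlusV v) := by
  simp only [zeroPlusV, ofPred_forall]
  exact isClosed_iInter fun ε => isClosed_iInter fun _ => ultrafilter_isClosed_basic _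

theorem add_mem_zeroPlusV {v : ℕ} {p q : Ultrafilter (Fin v → Rpos)} (hp : p ∈ zeroPlusV v)
    (hq : q ∈ zeroPlusV v) : p + q ∈ zeroPlusV v := by
  intro ε hε
  refine (Ultrafilter.eventually_add p q _).2 ?_
  filter_upwards [hp (ε / 2) (half_pos hε)] with x hx
  filter_upwards [hq (ε / 2) (half_pos hε)] with y hy j
  have h1 := hx j
  have h2 := hy j
  simp only [Pi.add_apply, Positive.coe_add]
  linarith

theorem Ultrafilter.map_add_of_additive {γ η : Type*} [AddSemigroup γ] [AddSemigroup η] (f : γ → η)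
    (hf : ∀ x y, f (x + y) = f x + f y) (p q : Ultrafilter γ) :
    (p + q).map f = p.map f + q.map f := by
  refine Ultrafilter.coe_le_coe.1 fun A hA => ?_
  have h : ∀ᶠ z in (p + q : Ultrafilter γ), f z ∈ A := by
    refine (Ultrafilter.eventually_add p q _).2 ?_
    simp only [hf]
    exact (Ultrafilter.eventually_add (p.map f) (q.map f) (· ∈ A)).1 hA
  exact h

/-- If every finite colouring admits a point where all `f i` have the same colour, then some
ultrafilter has the same image under all `f i`. -/
theorem exists_ultrafilter_map_eq {X Y κ : Type*} (f : κ → X → Y)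
    (h : ∀ (r : ℕ) (c : Y → Fin r), ∃ x, ∀ i k, c (f i x) = c (f k x)) :
    ∃ p : Ultrafilter X, ∀ i k, p.map (f i) = p.map (f k) := by
  classical
  obtain ⟨p, hp⟩ := Ultrafilter.exists_ultrafilter_of_finite_inter_nonempty
    (range fun A : Set Y => {x | ∀ i k, f i x ∈ A ↔ f k x ∈ A}) (by
      intro F hF
      have hF' : ∀ B ∈ F, ∃ A : Set Y, {x | ∀ i k, f i x ∈ A ↔ f k x ∈ A} = B :=
        fun B hB => hF hB
      choose! A hA using hF'
      let e := Fintype.equivFin (F → Prop)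
      obtain ⟨x, hx⟩ := h _ fun y => e fun B => y ∈ A B
      refine ⟨x, fun B hB => ?_⟩
      rw [← hA B hB]
      intro i k
      exact iff_of_eq (congrFun (e.injective (hx i k)) ⟨B, hB⟩))
  refine ⟨p, fun i k => Ultrafilter.coe_le_coe.1 fun A hA => ?_⟩
  have h1 : {x | ∀ i k, f i x ∈ A ↔ f k x ∈ A} ∈ p := hp ⟨A, rfl⟩
  have h2 : ∀ᶠ x in p, f k x ∈ A := hA
  have h3 : ∀ᶠ x in p, f i x ∈ A := by
    filter_upwards [h1, h2] with x hx hy using (hx i k).2 hy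
  exact h3

/-- If `M` is a `u × v` matrix with entries from `ℝ⁺ ∪ {0}` which is IPR/ℝ⁺ and `C ⊆ ℝ⁺`
is an SC\* set near zero in `ℝ⁺`, then `{x ∈ (ℝ⁺)^v : M·x ∈ C^u}` is an SC\* set near zero
in `(ℝ⁺)^v`. -/
theorem scStar_preserved {u v : ℕ} (hu : 1 ≤ u) (hv : 1 ≤ v)
    (M : Fin u → Fin v → ℝ) (hMnn : ∀ i j, 0 ≤ M i j) (hIPR : IPR M)
    (C : Set ℝ) (hC : C ⊆ Set.Ioi 0) (hSC : SCStar1 {a : Rpos | (a : ℝ) ∈ C}) :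
    SCStarV v {x : Fin v → Rpos | ∀ i : Fin u, (∑ j, M i j * (x j : ℝ)) ∈ C} := by

  have hpos : ∀ i (x : Fin v → Rpos), 0 < ∑ j, M i j * (x j : ℝ) := by
    intro i x
    obtain ⟨_, w, hw⟩ := hIPR 1 fun _ => 0
    obtain ⟨j, -, hj⟩ := Finset.exists_lt_of_sum_lt
      (show ∑ j : Fin v, (0 : ℝ) < ∑ j, M i j * (w j : ℝ) by simpa using (hw i).1)
    have hM : 0 < M i j := pos_of_mul_pos_left hj (w j).2.le
    exact Finset.sum_pos' (fun k _ => mul_nonneg (hMnn i k) (x k).2.le)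
      ⟨j, Finset.mem_univ j, mul_pos hM (x j).2⟩
  let f : Fin u → (Fin v → Rpos) → Rpos := fun i x => ⟨∑ j, M i j * (x j : ℝ), hpos i x⟩
  have hfadd : ∀ i x y, f i (x + y) = f i x + f i y := by
    intro i x y
    ext
    simp [f, mul_add, Finset.sum_add_distrib]
  obtain ⟨p₀, hp₀⟩ := exists_ultrafilter_map_eq f (by
    intro r c
    obtain ⟨i, x, hx⟩ := hIPR r c
    exact ⟨x, fun k l => (hx k).2.trans (hx l).2.symm⟩)
  let Λ : Fin u → (Fin v → ℝ) →L[ℝ] ℝ := fun i =>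
    ∑ j, M i j • ContinuousLinearMap.proj (R := ℝ) (φ := fun _ : Fin v => ℝ) j
  have hΛ : ∀ i y, Λ i y = ∑ j, M i j * y j := by
    intro i y
    simp [Λ]
  obtain ⟨L, hL, hLC⟩ := hSC
  obtain ⟨q, hqL⟩ := hL.1.1
  have hq : map ((↑) : Rpos → ℝ) q ≤ 𝓝 0 :=
    map_le_iff_le_comap.2 (mem_zeroPlus1_iff.1 (hL.1.2.1 hqL))
  have hsmall : ∀ A : Set Rpos, (∀ᶠ x in nearZero, ∀ᶠ y in q, x + y ∈ A) → ∀ ε : ℝ, 0 < ε →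
      ∃ x : Fin v → Rpos, (∀ j, (x j : ℝ) < ε) ∧ ∀ i, f i x ∈ A := by
    intro A hA ε hε
    have hfreq := frequently_forall_mem_of_thick p₀ (map ((↑) : Rpos → ℝ) q) hq ((↑) '' A)
      (by
        rw [← map_coe_nearZero]
        exact hA.mono fun x hx => hx.mono fun y hy => ⟨x + y, hy, rfl⟩)
      Λ (fun j : Fin v => ContinuousLinearMap.proj (R := ℝ) (φ := fun _ : Fin v => ℝ) j)
      Finset.univ univ univ (fun x j => (x j : ℝ)) (by simp)
      (fun i _ => Eventually.of_forall fun x => by simpa only [hΛ] using hpos i x)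
      (fun i _ k _ c hc => by
        simp only [hΛ] at hc
        refine ratio_limit_of_map_eq p₀ _ _ (Eventually.of_forall (hpos i))
          (Eventually.of_forall (hpos k)) ?_ c hc
        have := congrArg (Ultrafilter.map ((↑) : Rpos → ℝ)) (hp₀ i k)
        rw [Ultrafilter.map_map, Ultrafilter.map_map] at this
        exact this)
      (fun j _ => Eventually.of_forall fun x => (x j).2)
    obtain ⟨y, ⟨hyA, hypos⟩, hy⟩ :=
      (hfreq.and_eventually (Metric.ball_mem_nhds (0 : Fin v → ℝ) hε)).exists
    refine ⟨fun j => ⟨y j, hypos j trivial⟩, fun j => ?_, fun i => ?_⟩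
    · exact (le_abs_self _).trans_lt ((norm_le_pi_norm y j).trans_lt (mem_ball_zero_iff.1 hy))
    · obtain ⟨a, ha, hay⟩ := hyA i trivial
      rw [hΛ] at hay
      convert ha
      exact Subtype.ext hay.symm
  obtain ⟨p, hpT, hpL⟩ : ∃ p ∈ zeroPlusV v, ∀ i, p.map (f i) ∈ L := by
    obtain ⟨p, hp⟩ := Ultrafilter.exists_ultrafilter_of_finite_inter_nonempty
      {B : Set (Fin v → Rpos) | ∃ A : Set Rpos, (∀ᶠ x in nearZero, ∀ᶠ y in q, x + y ∈ A) ∧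
        ∃ ε : ℝ, 0 < ε ∧ {x | (∀ j, (x j : ℝ) < ε) ∧ ∀ i, f i x ∈ A} ⊆ B} (by
        intro F hF
        have hF' : ∀ B ∈ F, ∃ A : Set Rpos, (∀ᶠ x in nearZero, ∀ᶠ y in q, x + y ∈ A) ∧
            ∃ ε : ℝ, 0 < ε ∧ {x | (∀ j, (x j : ℝ) < ε) ∧ ∀ i, f i x ∈ A} ⊆ B :=
          fun B hB => hF hB
        choose! A hA ε hε hsub using hF'
        obtain ⟨δ, hδ, hδF⟩ : ∃ δ : ℝ, 0 < δ ∧ ∀ B ∈ F, δ ≤ ε B := by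
          have : ∀ᶠ δ in 𝓝[>] (0 : ℝ), ∀ B ∈ F, δ ≤ ε B :=
            (Finset.eventually_all F).2 fun B hB =>
              nhdsWithin_le_nhds (ge_mem_nhds (hε B hB))
          obtain ⟨δ, h1, h2⟩ := (this.and self_mem_nhdsWithin).exists
          exact ⟨δ, h2, h1⟩
        obtain ⟨x, hx, hxA⟩ := hsmall (⋂ B ∈ F, A B) (by
          have : ∀ᶠ x in nearZero, ∀ B ∈ F, ∀ᶠ y in q, x + y ∈ A B :=
            (Finset.eventually_all F).2 fun B hB => hA B hB
          filter_upwards [this] with x hx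
          filter_upwards [(Finset.eventually_all F).2 hx] with y hy
          simpa using hy) δ hδ
        refine ⟨x, fun B hB => hsub B hB ⟨fun j => (hx j).trans_le (hδF B hB), fun i => ?_⟩⟩
        exact mem_iInter₂.1 (hxA i) B hB)
    refine ⟨p, fun ε hε => hp ⟨univ, by simp, ε, hε, fun x hx => hx.1⟩, fun i => ?_⟩
    obtain ⟨t, ht, hti⟩ := exists_eq_add_of_le (q := q) (r := p.map (f i))
      fun A hA => hp ⟨A, hA, 1, one_pos, fun x hx => hx.2 i⟩
    rw [hti]
    exact hL.1.2.2 t ht q hqL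
  have hmapT : ∀ i, ∀ t ∈ zeroPlusV v, t.map (f i) ∈ zeroPlus1 := by
    intro i t ht
    have hlim : Tendsto (fun y => Λ i y) (𝓝 0) (𝓝 0) := (Λ i).continuous.tendsto' 0 0 (map_zero _)
    intro ε hε
    obtain ⟨δ, hδ, hball⟩ := Metric.mem_nhds_iff.1 (hlim.eventually (gt_mem_nhds hε))
    have h : ∀ᶠ x in t, (f i x : ℝ) < ε := by
      filter_upwards [ht δ hδ] with x hx
      have : (fun j => (x j : ℝ)) ∈ Metric.ball (0 : Fin v → ℝ) δ := by
        rw [mem_ball_zero_iff, pi_norm_lt_iff hδ]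
        intro j
        rw [Real.norm_of_nonneg (x j).2.le]
        exact hx j
      have hlt : Λ i (fun j => (x j : ℝ)) < ε := hball this
      rwa [hΛ] at hlt
    exact h
  obtain ⟨N, hNsub, hN⟩ := exists_minimalLeftIdeal_subset (zeroPlusV v) (isClosed_zeroPlusV v)
    (fun _ hs _ ht => add_mem_zeroPlusV hs ht)
    {r ∈ zeroPlusV v | ∀ i, r.map (f i) ∈ L}
    ⟨⟨p, hpT, hpL⟩, fun r hr => hr.1, fun t ht r hr => ⟨add_mem_zeroPlusV ht hr.1, fun i => by
      rw [Ultrafilter.map_add_of_additive _ (hfadd i)]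
      exact hL.1.2.2 _ (hmapT i t ht) _ (hr.2 i)⟩⟩
  refine ⟨N, hN, fun r hr hrr => ?_⟩
  refine eventually_all.2 fun i => ?_
  have hidem : r.map (f i) + r.map (f i) = r.map (f i) := by
    rw [← Ultrafilter.map_add_of_additive _ (hfadd i), hrr]
  exact hLC _ ((hNsub hr).2 i) hidem
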